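/- arXiv:0905.1165 — 3 statements merged into one kernel-verified Lean document; each statement's English description precedes it below -/
import Mathlib

section
/- Let (X, 𝒜, m) be a measure space, f, g : X → ℕ measurable functions, and N ∈ ℕ. Then, in the extended nonnegative reals, ∫ |f − g| dm ≤ Σ_{j=N}^∞ m({x : f(x) > j}) + Σ_{j=0}^{N−1} m({x : f(x) > j} Δ {x : g(x) > j}) + Σ_{j=N}^∞ m({x : g(x) > j}), where Δ denotes symmetric difference of sets. -/
open MeasureTheory
open scoped ENNReal

lemma mem_symmDiff_setOf_lt_iff {X : Type*} (f g : X → ℕ) (x : X) (j : ℕ) :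
    x ∈ symmDiff {x | j < f x} {x | j < g x} ↔
      j ∈ Finset.Ico (min (f x) (g x)) (max (f x) (g x)) := by
  simp only [Set.mem_symmDiff, Set.mem_ofPred_eq, Finset.mem_Ico]
  omega

lemma natAbs_sub_eq_tsum_indicator_symmDiff {X : Type*} (f g : X → ℕ) (x : X) :
    (((f x : ℤ) - (g x : ℤ)).natAbs : ℝ≥0∞) =
      ∑' j : ℕ, (symmDiff {x | j < f x} {x | j < g x}).indicator 1 x := by
  classical
  simp only [Set.indicator_apply, mem_symmDiff_setOf_lt_iff, Pi.one_apply]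
  rw [tsum_eq_sum (s := Finset.Ico (min (f x) (g x)) (max (f x) (g x)))
    fun j hj => if_neg hj, Finset.sum_ite_mem, Finset.inter_self, Finset.sum_const,
    Nat.card_Ico, nsmul_one]
  congr 1
  omega

lemma lintegral_natAbs_sub_eq_tsum_measure_symmDiff
    {X : Type*} [MeasurableSpace X] (m : Measure X)
    {f g : X → ℕ} (hf : Measurable f) (hg : Measurable g) :
    ∫⁻ x, (((f x : ℤ) - (g x : ℤ)).natAbs : ℝ≥0∞) ∂m =
      ∑' j : ℕ, m (symmDiff {x | j < f x} {x | j < g x}) := by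
  have hs (j : ℕ) : MeasurableSet (symmDiff {x | j < f x} {x | j < g x}) :=
    (measurableSet_lt measurable_const hf).symmDiff (measurableSet_lt measurable_const hg)
  simp_rw [natAbs_sub_eq_tsum_indicator_symmDiff]
  rw [lintegral_tsum fun j => (measurable_one.indicator (hs j)).aemeasurable]
  exact tsum_congr fun j => lintegral_indicator_one (hs j)

/-- three-term splitting in the proof of Lemma `le.impu1`.
For measurable `f g : X → ℕ` and every `N`,
`∫ |f - g| dm ≤ Σ_{j≥N} m{f > j} + Σ_{j<N} m({f > j} Δ {g > j}) + Σ_{j≥N} m{g > j}`. -/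
theorem lintegral_abs_sub_le_tail_splitting
    {X : Type*} [MeasurableSpace X] (m : Measure X)
    (f g : X → ℕ) (hf : Measurable f) (hg : Measurable g) (N : ℕ) :
    ∫⁻ x, (((f x : ℤ) - (g x : ℤ)).natAbs : ℝ≥0∞) ∂m
      ≤ (∑' j : ℕ, m {x | N + j < f x})
        + (∑ j ∈ Finset.range N, m (symmDiff {x | j < f x} {x | j < g x}))
        + ∑' j : ℕ, m {x | N + j < g x} := by
  rw [lintegral_natAbs_sub_eq_tsum_measure_symmDiff m hf hg,
    ← ENNReal.summable.sum_add_tsum_nat_add' (k := N), add_right_comm, ← ENNReal.tsum_add,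
    add_comm]
  gcongr with j
  rw [add_comm j N]
  exact (measure_mono symmDiff_le_sup).trans (measure_union_le _ _)
end

section
/- Let (X, 𝒜, m) be a probability space, K ≥ 1, and T : X → X a measurable map such that for every i ≥ 1 the pushforward T^i_* m is absolutely continuous with respect to m with Radon–Nikodym derivative d(T^i_* m)/dm taking values in [K^{-1}, K] m-almost everywhere. Then there exists a T-invariant probability measure μ on X (i.e. T_*μ = μ) which is absolutely continuous with respect to m, with density ρ = dμ/dm satisfying K^{-1} ≤ ρ ≤ K m-almost everywhere. -/
open MeasureTheory Filter

open scoped ENNReal Topology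

/-- A family of measures dominated by a finite measure converges setwise along any ultrafilter. -/
theorem exists_measure_tendsto_of_le {X ι : Type*} [MeasurableSpace X] (u : Ultrafilter ι)
    (ν : ι → Measure X) (l : Measure X) [IsFiniteMeasure l] (h : ∀ i, ν i ≤ l) :
    ∃ μ : Measure X, ∀ A, MeasurableSet A → Tendsto (fun i => ν i A) u (𝓝 (μ A)) := by
  have key (A : Set X) : ∃ a, Tendsto (fun i => ν i A) u (𝓝 a) :=
    ⟨_, (u.map fun i => ν i A).le_nhds_lim⟩
  choose a ha using key
  have ale (A : Set X) : a A ≤ l A := le_of_tendsto' (ha A) fun i => h i A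
  refine ⟨Measure.ofMeasurable (fun A _ => a A) ?_ ?_, fun A hA => ?_⟩
  · simpa using ale ∅
  · intro f hf hd
    have hl : ∑' k, l (f k) ≠ ∞ := by
      rw [← measure_iUnion hd hf]
      exact measure_ne_top _ _
    have hfin (i : ι) (A : Set X) : ν i A ≠ ∞ := ne_top_of_le_ne_top (measure_ne_top l A) (h i A)
    have hafin (A : Set X) : a A ≠ ∞ := ne_top_of_le_ne_top (measure_ne_top l A) (ale A)
    have hsum : Tendsto (fun i => ∑' k, (ν i (f k)).toReal) u (𝓝 (∑' k, (a (f k)).toReal)) := by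
      refine tendsto_tsum_of_dominated_convergence (ENNReal.summable_toReal hl)
        (fun k => (ENNReal.tendsto_toReal (hafin _)).comp (ha _)) (Eventually.of_forall fun i k => ?_)
      rw [Real.norm_of_nonneg ENNReal.toReal_nonneg]
      exact ENNReal.toReal_mono (measure_ne_top _ _) (h i _)
    have hU := (ENNReal.tendsto_toReal (hafin (⋃ k, f k))).comp (ha (⋃ k, f k))
    have heq : (a (⋃ k, f k)).toReal = ∑' k, (a (f k)).toReal := by
      refine tendsto_nhds_unique hU (hsum.congr fun i => ?_)
      rw [Function.comp_apply, measure_iUnion hd hf, ENNReal.tsum_toReal_eq fun k => hfin i _]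
    rw [← ENNReal.tsum_toReal_eq fun k => hafin _] at heq
    exact (ENNReal.toReal_eq_toReal_iff' (hafin _)
      (ne_top_of_le_ne_top hl (ENNReal.tsum_le_tsum fun k => ale _))).1 heq
  · rw [Measure.ofMeasurable_apply A hA]
    exact ha A

/-- Bounds on the Radon-Nikodym derivative are equivalent to setwise bounds. -/
theorem rnDeriv_mem_Icc_iff {X : Type*} [MeasurableSpace X] {m μ : Measure X}
    [IsFiniteMeasure m] [IsFiniteMeasure μ] (hμ : μ ≪ m) {c C : ℝ≥0∞} :
    (∀ᵐ x ∂m, μ.rnDeriv m x ∈ Set.Icc c C) ↔ c • m ≤ μ ∧ μ ≤ C • m := by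
  constructor
  · intro h
    have hd := Measure.withDensity_rnDeriv_eq μ m hμ
    rw [← withDensity_const c, ← withDensity_const C]
    constructor
    · exact (withDensity_mono (h.mono fun x hx => hx.1)).trans_eq hd
    · exact hd.symm.trans_le (withDensity_mono (h.mono fun x hx => hx.2))
  · rintro ⟨h₁, h₂⟩
    have lower : (fun _ => c) ≤ᵐ[m] μ.rnDeriv m := by
      refine ae_le_of_forall_setLIntegral_le_of_sigmaFinite measurable_const fun s hs _ => ?_
      rw [Measure.setLIntegral_rnDeriv hμ, setLIntegral_const]
      exact h₁ s
    have upper : μ.rnDeriv m ≤ᵐ[m] fun _ => C := by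
      refine ae_le_of_forall_setLIntegral_le_of_sigmaFinite (μ.measurable_rnDeriv m)
        fun s hs _ => ?_
      rw [Measure.setLIntegral_rnDeriv hμ, setLIntegral_const]
      exact h₂ s
    filter_upwards [lower, upper] with x hx hx' using ⟨hx, hx'⟩

/-- The Cesàro averages of the iterated pushforwards `T^i_* m`, `1 ≤ i ≤ n + 1`. -/
noncomputable def cesaroMap {X : Type*} [MeasurableSpace X] (m : Measure X) (T : X → X) (n : ℕ) :
    Measure X :=
  ((n + 1 : ℕ) : ℝ≥0∞)⁻¹ • ∑ i ∈ Finset.range (n + 1), Measure.map (T^[i + 1]) m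

theorem cesaroMap_apply {X : Type*} [MeasurableSpace X] (m : Measure X) (T : X → X) (n : ℕ)
    (A : Set X) : cesaroMap m T n A =
      ((n + 1 : ℕ) : ℝ≥0∞)⁻¹ * ∑ i ∈ Finset.range (n + 1), Measure.map (T^[i + 1]) m A := by
  simp [cesaroMap]

theorem inv_mul_sum_const (n : ℕ) (b : ℝ≥0∞) :
    ((n + 1 : ℕ) : ℝ≥0∞)⁻¹ * ∑ _i ∈ Finset.range (n + 1), b = b := by
  rw [Finset.sum_const, Finset.card_range, nsmul_eq_mul, ← mul_assoc,
    ENNReal.inv_mul_cancel (by simp) (ENNReal.natCast_ne_top _), one_mul]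

theorem cesaroMap_le {X : Type*} [MeasurableSpace X] {m l : Measure X} {T : X → X}
    (h : ∀ i, Measure.map (T^[i + 1]) m ≤ l) (n : ℕ) : cesaroMap m T n ≤ l := fun A => by
  rw [cesaroMap_apply, ← inv_mul_sum_const n (l A)]
  gcongr with i
  exact h i

theorem le_cesaroMap {X : Type*} [MeasurableSpace X] {m l : Measure X} {T : X → X}
    (h : ∀ i, l ≤ Measure.map (T^[i + 1]) m) (n : ℕ) : l ≤ cesaroMap m T n := fun A => by
  rw [cesaroMap_apply, ← inv_mul_sum_const n (l A)]
  gcongr with i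
  exact h i

theorem cesaroMap_preimage_add {X : Type*} [MeasurableSpace X] (m : Measure X) {T : X → X}
    (hT : Measurable T) (n : ℕ) {A : Set X} (hA : MeasurableSet A) :
    cesaroMap m T n (T ⁻¹' A) + ((n + 1 : ℕ) : ℝ≥0∞)⁻¹ * Measure.map T m A =
      cesaroMap m T n A + ((n + 1 : ℕ) : ℝ≥0∞)⁻¹ * Measure.map (T^[n + 2]) m A := by
  have hshift (i : ℕ) : Measure.map (T^[i + 1]) m (T ⁻¹' A) = Measure.map (T^[i + 2]) m A := by
    rw [Measure.map_apply (hT.iterate _) (hT hA), Measure.map_apply (hT.iterate _) hA,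
      ← Set.preimage_comp, ← Function.iterate_succ']
  simp only [cesaroMap_apply, hshift, ← mul_add]
  rw [← Finset.sum_range_succ (fun i => Measure.map (T^[i + 1]) m A),
    Finset.sum_range_succ' _ (n + 1)]
  rfl

theorem tendsto_inv_succ_mul {b : ℕ → ℝ≥0∞} (hb : ∀ n, b n ≤ 1) :
    Tendsto (fun n : ℕ => ((n + 1 : ℕ) : ℝ≥0∞)⁻¹ * b n) atTop (𝓝 0) :=
  tendsto_of_tendsto_of_tendsto_of_le_of_le tendsto_const_nhds
    (ENNReal.tendsto_inv_nat_nhds_zero.comp (tendsto_add_atTop_nat 1))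
    (fun _ => zero_le) (fun n => mul_le_of_le_one_right' (hb n))

/-- abstract form of Lemma `lem:small-adjust`. If every pushforward
`T^i_* m` (`i ≥ 1`) is absolutely continuous w.r.t. `m` with density in `[K⁻¹, K]` a.e.,
then there is a `T`-invariant probability measure `μ ≪ m` whose density `ρ = dμ/dm`
satisfies `K⁻¹ ≤ ρ ≤ K` m-a.e. -/
theorem exists_invariant_density_two_sided_bounds
    {X : Type*} [MeasurableSpace X] (m : Measure X) [IsProbabilityMeasure m]
    (K : ℝ) (hK : 1 ≤ K) (T : X → X) (hT : Measurable T)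
    (hac : ∀ i : ℕ, 1 ≤ i → Measure.map (T^[i]) m ≪ m)
    (hdens : ∀ i : ℕ, 1 ≤ i → ∀ᵐ x ∂m,
      (Measure.map (T^[i]) m).rnDeriv m x ∈
        Set.Icc (ENNReal.ofReal K⁻¹) (ENNReal.ofReal K)) :
    ∃ μ : Measure X, IsProbabilityMeasure μ ∧ Measure.map T μ = μ ∧ μ ≪ m ∧
      ∀ᵐ x ∂m, μ.rnDeriv m x ∈ Set.Icc (ENNReal.ofReal K⁻¹) (ENNReal.ofReal K) := by
  have hprob (i : ℕ) : IsProbabilityMeasure (Measure.map (T^[i]) m) :=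
    Measure.isProbabilityMeasure_map (hT.iterate i).aemeasurable
  have hb (i : ℕ) := (rnDeriv_mem_Icc_iff (hac (i + 1) (by simp))).1 (hdens (i + 1) (by simp))
  have : IsFiniteMeasure (ENNReal.ofReal K • m) := m.smul_finite ENNReal.ofReal_ne_top
  obtain ⟨μ, hμ⟩ := exists_measure_tendsto_of_le (hyperfilter ℕ) (cesaroMap m T)
    (ENNReal.ofReal K • m) (cesaroMap_le fun i => (hb i).2)
  have hle : μ ≤ ENNReal.ofReal K • m := Measure.le_iff.2 fun A hA =>
    le_of_tendsto' (hμ A hA) fun n => cesaroMap_le (fun i => (hb i).2) n A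
  have hge : ENNReal.ofReal K⁻¹ • m ≤ μ := Measure.le_iff.2 fun A hA =>
    ge_of_tendsto' (hμ A hA) fun n => le_cesaroMap (fun i => (hb i).1) n A
  have hμm : μ ≪ m := hle.absolutelyContinuous.trans Measure.smul_absolutelyContinuous
  have hμprob : IsProbabilityMeasure μ := by
    refine ⟨tendsto_nhds_unique (hμ _ MeasurableSet.univ) ?_⟩
    simp only [cesaroMap_apply, measure_univ, inv_mul_sum_const]
    exact tendsto_const_nhds
  refine ⟨μ, hμprob, Measure.ext fun A hA => ?_, hμm, (rnDeriv_mem_Icc_iff hμm).2 ⟨hge, hle⟩⟩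
  have hatTop : (hyperfilter ℕ : Filter ℕ) ≤ atTop := Nat.hyperfilter_le_atTop
  have h₁ := (hμ _ (hT hA)).add ((tendsto_inv_succ_mul
    (b := fun _ => Measure.map (T^[1]) m A) fun _ => prob_le_one).mono_left hatTop)
  have h₂ := (hμ A hA).add ((tendsto_inv_succ_mul
    (b := fun n => Measure.map (T^[n + 2]) m A) fun _ => prob_le_one).mono_left hatTop)
  rw [Measure.map_apply hT hA, ← add_zero (μ A), ← add_zero (μ (T ⁻¹' A))]
  exact tendsto_nhds_unique h₁ (h₂.congr fun n => (cesaroMap_preimage_add m hT n hA).symm)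
end

section
/- Let (X, 𝒜, m) be a probability space, W ∈ 𝒜 a set with m(W) > 0, and S : W → X a measurable bijection onto X. Suppose there is a measurable function J : W → (0, ∞) such that m(S(E)) = ∫_E J dm for every measurable E ⊆ W, and suppose there is C ≥ 1 with J(x) ≤ C · J(y) for all x, y ∈ W. Then for every measurable set A ⊆ X one has m(W ∩ S^{-1}(A)) ≤ C · m(A) · m(W). -/
open MeasureTheory
open scoped ENNReal

/-- key estimate in the proof of Lemma `lem:choice-N5`. If `S` maps `W`
bijectively onto `X`, the Jacobian `J` of `S` w.r.t. `m` satisfies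
`m(S(E)) = ∫_E J dm` for measurable `E ⊆ W`, and `J` has bounded distortion
`J(x) ≤ C·J(y)` on `W`, then `m(W ∩ S⁻¹(A)) ≤ C · m(A) · m(W)` for every measurable `A`. -/
theorem bounded_distortion_cylinder_estimate
    {X : Type*} [MeasurableSpace X] (m : Measure X) [IsProbabilityMeasure m]
    (W : Set X) (hW : MeasurableSet W) (hWpos : 0 < m W)
    (S : X → X) (hS : Measurable S) (hbij : Set.BijOn S W Set.univ)
    (J : X → ℝ≥0∞) (hJ : Measurable J)
    (hJpos : ∀ x ∈ W, 0 < J x ∧ J x ≠ ⊤)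
    (hjac : ∀ E : Set X, E ⊆ W → MeasurableSet E → m (S '' E) = ∫⁻ x in E, J x ∂m)
    (C : ℝ) (hC : 1 ≤ C)
    (hdist : ∀ x ∈ W, ∀ y ∈ W, J x ≤ ENNReal.ofReal C * J y) :
    ∀ A : Set X, MeasurableSet A →
      m (W ∩ S ⁻¹' A) ≤ ENNReal.ofReal C * m A * m W := by
  intro A hA
  have hE : MeasurableSet (W ∩ S ⁻¹' A) := hW.inter (hS hA)
  have himage : S '' (W ∩ S ⁻¹' A) = A := by
    rw [Set.image_inter_preimage, hbij.image_eq, Set.univ_inter]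
  have hmA : m A = ∫⁻ x in W ∩ S ⁻¹' A, J x ∂m := by
    rw [← hjac _ Set.inter_subset_left hE, himage]
  have htotal : ∫⁻ y in W, J y ∂m = 1 := by
    rw [← hjac W subset_rfl hW, hbij.image_eq, measure_univ]
  have hlower : ∀ x ∈ W, 1 ≤ ENNReal.ofReal C * m W * J x := fun x hx =>
    calc 1 = ∫⁻ y in W, J y ∂m := htotal.symm
      _ ≤ ∫⁻ _ in W, ENNReal.ofReal C * J x ∂m :=
        setLIntegral_mono' hW fun y hy => hdist y hy x hx
      _ = ENNReal.ofReal C * m W * J x := by rw [setLIntegral_const]; ring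
  calc m (W ∩ S ⁻¹' A) = ∫⁻ _ in W ∩ S ⁻¹' A, 1 ∂m := (setLIntegral_one _).symm
    _ ≤ ∫⁻ x in W ∩ S ⁻¹' A, ENNReal.ofReal C * m W * J x ∂m :=
      setLIntegral_mono' hE fun x hx => hlower x hx.1
    _ = ENNReal.ofReal C * m A * m W := by
      rw [lintegral_const_mul _ hJ, ← hmA]; ring
end
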